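/- arXiv:2406.18316 — 2 statements merged into one kernel-verified Lean document; each statement's English description precedes it below -/
import Mathlib

section
/- Let 𝒢_Lie be a Lie-closed set of n-qubit Pauli strings, let P, Q ∈ 𝒢_Lie commute with each other and be 𝔤-connected with respect to 𝒢_Lie, and let M be an n-qubit Pauli string that is 𝔤-connected to Q with respect to 𝒢_Lie. Suppose there exists R ∈ 𝒢_Lie such that either (R anticommutes with P and commutes with Q) or (R commutes with P and anticommutes with Q). Then there exists S ∈ 𝒢_Lie that anticommutes with M and such that either (S anticommutes with P and commutes with Q) or (S commutes with P and anticommutes with Q). -/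
open Matrix

noncomputable section

/-- The four single-qubit Pauli matrices: I, X, Y, Z. -/
def pauli1 : Fin 4 → Matrix (Fin 2) (Fin 2) ℂ :=
  ![1, !![0, 1; 1, 0], !![0, -Complex.I; Complex.I, 0], !![1, 0; 0, -1]]

/-- The `n`-qubit Pauli string determined by `f : Fin n → Fin 4`. -/
def PauliString (n : ℕ) (f : Fin n → Fin 4) :
    Matrix (Fin n → Fin 2) (Fin n → Fin 2) ℂ :=
  fun x y => ∏ i, pauli1 (f i) (x i) (y i)

/-- Two matrices commute. -/
def MComm {n : ℕ} (A B : Matrix (Fin n → Fin 2) (Fin n → Fin 2) ℂ) : Prop :=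
  A * B = B * A

/-- Two matrices anticommute. -/
def MAntiComm {n : ℕ} (A B : Matrix (Fin n → Fin 2) (Fin n → Fin 2) ℂ) : Prop :=
  A * B = -(B * A)

/-- A matrix is an `n`-qubit Pauli string. -/
def IsPauli {n : ℕ} (A : Matrix (Fin n → Fin 2) (Fin n → Fin 2) ℂ) : Prop :=
  ∃ f : Fin n → Fin 4, A = PauliString n f

/-- A set of `n`-qubit Pauli strings is Lie-closed: whenever two of its members
anticommute, the (unique) Pauli string appearing, up to a unit scalar, in their
product also belongs to the set. -/
def LieClosed {n : ℕ} (𝒢 : Set (Matrix (Fin n → Fin 2) (Fin n → Fin 2) ℂ)) : Prop :=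
  ∀ P ∈ 𝒢, ∀ Q ∈ 𝒢, MAntiComm P Q →
    ∀ (c : ℂ) (R : Matrix (Fin n → Fin 2) (Fin n → Fin 2) ℂ),
      ‖c‖ = 1 → IsPauli R → P * Q = c • R → R ∈ 𝒢

/-- `P` and `Q` are `𝔤`-connected with respect to `𝒢`: they are distinct and
joined by a chain of anticommutations passing through elements of `𝒢`
(the empty chain meaning that `P` and `Q` themselves anticommute). -/
def GConnected {n : ℕ} (𝒢 : Set (Matrix (Fin n → Fin 2) (Fin n → Fin 2) ℂ))
    (P Q : Matrix (Fin n → Fin 2) (Fin n → Fin 2) ℂ) : Prop :=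
  P ≠ Q ∧ ∃ l : List (Matrix (Fin n → Fin 2) (Fin n → Fin 2) ℂ),
    (∀ R ∈ l, R ∈ 𝒢) ∧ List.Chain' MAntiComm (P :: (l ++ [Q]))

section PauliAlgebra

variable {n : ℕ}

theorem pauliString_mul_apply (f g : Fin n → Fin 4) (x y : Fin n → Fin 2) :
    (PauliString n f * PauliString n g) x y =
      ∏ i, (pauli1 (f i) * pauli1 (g i)) (x i) (y i) := by
  simp only [Matrix.mul_apply, PauliString, ← Finset.prod_mul_distrib]
  rw [Finset.prod_univ_sum, Fintype.piFinset_univ]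

theorem exists_pauli1_mul_eq_smul (a b : Fin 4) :
    ∃ (c : ℂ) (d : Fin 4), ‖c‖ = 1 ∧ pauli1 a * pauli1 b = c • pauli1 d := by
  have key : ∀ (c : ℂ) (d : Fin 4), ‖c‖ = 1 → pauli1 a * pauli1 b = c • pauli1 d →
      ∃ (c : ℂ) (d : Fin 4), ‖c‖ = 1 ∧ pauli1 a * pauli1 b = c • pauli1 d :=
    fun c d h₁ h₂ => ⟨c, d, h₁, h₂⟩
  fin_cases a <;> fin_cases b
  · exact key 1 0 (by simp) (by simp [pauli1])
  · exact key 1 1 (by simp) (by simp [pauli1])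
  · exact key 1 2 (by simp) (by simp [pauli1])
  · exact key 1 3 (by simp) (by simp [pauli1])
  · exact key 1 1 (by simp) (by simp [pauli1])
  · exact key 1 0 (by simp) (by simp [pauli1, Matrix.one_fin_two])
  · exact key Complex.I 3 (by simp) (by simp [pauli1])
  · exact key (-Complex.I) 2 (by simp) (by simp [pauli1])
  · exact key 1 2 (by simp) (by simp [pauli1])
  · exact key (-Complex.I) 3 (by simp) (by simp [pauli1])
  · exact key 1 0 (by simp) (by simp [pauli1, Matrix.one_fin_two])
  · exact key Complex.I 1 (by simp) (by simp [pauli1])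
  · exact key 1 3 (by simp) (by simp [pauli1])
  · exact key Complex.I 2 (by simp) (by simp [pauli1])
  · exact key (-Complex.I) 1 (by simp) (by simp [pauli1])
  · exact key 1 0 (by simp) (by simp [pauli1, Matrix.one_fin_two])

theorem pauli1_mul_eq_sign_smul (a b : Fin 4) :
    ∃ s : ℤˣ, pauli1 a * pauli1 b = ((s : ℤ) : ℂ) • (pauli1 b * pauli1 a) := by
  suffices pauli1 a * pauli1 b = pauli1 b * pauli1 a ∨
      pauli1 a * pauli1 b = -(pauli1 b * pauli1 a) by
    rcases this with h | h
    · exact ⟨1, by simpa using h⟩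
    · exact ⟨-1, by simpa using h⟩
  fin_cases a <;> fin_cases b <;> simp [pauli1]

theorem IsPauli.exists_mul_eq_smul {A B : Matrix (Fin n → Fin 2) (Fin n → Fin 2) ℂ}
    (hA : IsPauli A) (hB : IsPauli B) :
    ∃ (c : ℂ) (C : Matrix (Fin n → Fin 2) (Fin n → Fin 2) ℂ),
      ‖c‖ = 1 ∧ IsPauli C ∧ A * B = c • C := by
  obtain ⟨f, rfl⟩ := hA
  obtain ⟨g, rfl⟩ := hB
  choose c d hc hd using exists_pauli1_mul_eq_smul
  refine ⟨∏ i, c (f i) (g i), PauliString n fun i => d (f i) (g i), ?_, ⟨_, rfl⟩, ?_⟩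
  · simp [norm_prod, hc]
  · ext x y
    simp [pauliString_mul_apply, hd, PauliString, Finset.prod_mul_distrib]

theorem IsPauli.mComm_or_mAntiComm {A B : Matrix (Fin n → Fin 2) (Fin n → Fin 2) ℂ}
    (hA : IsPauli A) (hB : IsPauli B) : MComm A B ∨ MAntiComm A B := by
  obtain ⟨f, rfl⟩ := hA
  obtain ⟨g, rfl⟩ := hB
  choose s hs using pauli1_mul_eq_sign_smul
  have h : PauliString n f * PauliString n g =
      (((∏ i, s (f i) (g i) : ℤˣ) : ℤ) : ℂ) • (PauliString n g * PauliString n f) := by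
    ext x y
    rw [Matrix.smul_apply, pauliString_mul_apply, pauliString_mul_apply]
    simp [hs (f _) (g _), Finset.prod_mul_distrib]
  rcases Int.units_eq_one_or (∏ i, s (f i) (g i)) with h₁ | h₁ <;> rw [h₁] at h
  · exact Or.inl (by simpa [MComm] using h)
  · exact Or.inr (by simpa [MAntiComm] using h)

variable {A B C X : Matrix (Fin n → Fin 2) (Fin n → Fin 2) ℂ} {c : ℂ}

theorem MComm.of_mul_eq_smul (hc : c ≠ 0) (h : A * B = c • C)
    (hA : MComm A X) (hB : MComm B X) : MComm C X := by
  unfold MComm at *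
  apply smul_right_injective _ hc
  simp only
  rw [← smul_mul_assoc, ← mul_smul_comm, ← h, mul_assoc, hB, ← mul_assoc, hA, mul_assoc]

theorem MComm.of_mul_eq_smul_of_mAntiComm (hc : c ≠ 0) (h : A * B = c • C)
    (hA : MAntiComm A X) (hB : MAntiComm B X) : MComm C X := by
  unfold MComm MAntiComm at *
  apply smul_right_injective _ hc
  simp only
  rw [← smul_mul_assoc, ← mul_smul_comm, ← h, mul_assoc, hB, mul_neg, ← mul_assoc, hA,
    neg_mul, neg_neg, mul_assoc]

theorem MAntiComm.of_mul_eq_smul_left (hc : c ≠ 0) (h : A * B = c • C)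
    (hA : MAntiComm A X) (hB : MComm B X) : MAntiComm C X := by
  unfold MComm MAntiComm at *
  apply smul_right_injective _ hc
  simp only
  rw [smul_neg, ← smul_mul_assoc, ← mul_smul_comm, ← h, mul_assoc, hB, ← mul_assoc, hA,
    neg_mul, mul_assoc]

theorem MAntiComm.of_mul_eq_smul_right (hc : c ≠ 0) (h : A * B = c • C)
    (hA : MComm A X) (hB : MAntiComm B X) : MAntiComm C X := by
  unfold MComm MAntiComm at *
  apply smul_right_injective _ hc
  simp only
  rw [smul_neg, ← smul_mul_assoc, ← mul_smul_comm, ← h, mul_assoc, hB, mul_neg, ← mul_assoc,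
    hA, mul_assoc]

/-- `A` anticommutes with exactly one of `P`, `Q` and commutes with the other. -/
def Distinguishes (A P Q : Matrix (Fin n → Fin 2) (Fin n → Fin 2) ℂ) : Prop :=
  (MAntiComm A P ∧ MComm A Q) ∨ (MComm A P ∧ MAntiComm A Q)

theorem Distinguishes.of_mul_eq_smul {P Q : Matrix (Fin n → Fin 2) (Fin n → Fin 2) ℂ}
    (hc : c ≠ 0) (h : A * B = c • C) (hA : Distinguishes A P Q)
    (hB : (MComm B P ∧ MComm B Q) ∨ (MAntiComm B P ∧ MAntiComm B Q)) :
    Distinguishes C P Q := by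
  rcases hA with ⟨h₁, h₂⟩ | ⟨h₁, h₂⟩ <;> rcases hB with ⟨h₃, h₄⟩ | ⟨h₃, h₄⟩
  · exact Or.inl ⟨.of_mul_eq_smul_left hc h h₁ h₃, .of_mul_eq_smul hc h h₂ h₄⟩
  · exact Or.inr ⟨.of_mul_eq_smul_of_mAntiComm hc h h₁ h₃, .of_mul_eq_smul_right hc h h₂ h₄⟩
  · exact Or.inr ⟨.of_mul_eq_smul hc h h₁ h₃, .of_mul_eq_smul_left hc h h₂ h₄⟩
  · exact Or.inl ⟨.of_mul_eq_smul_right hc h h₁ h₃, .of_mul_eq_smul_of_mAntiComm hc h h₂ h₄⟩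

/-- A chain of anticommutations inside a Lie-closed set, from a distinguishing element to `M`,
can be contracted to a distinguishing element that anticommutes with `M` directly. -/
theorem LieClosed.exists_distinguishes_of_isChain
    {𝒢 : Set (Matrix (Fin n → Fin 2) (Fin n → Fin 2) ℂ)}
    (h𝒢pauli : ∀ A ∈ 𝒢, IsPauli A) (h𝒢lie : LieClosed 𝒢)
    {P Q M : Matrix (Fin n → Fin 2) (Fin n → Fin 2) ℂ}
    (hP : IsPauli P) (hQ : IsPauli Q) (hM : IsPauli M)
    (l : List (Matrix (Fin n → Fin 2) (Fin n → Fin 2) ℂ)) (hl : ∀ R ∈ l, R ∈ 𝒢)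
    (hA : A ∈ 𝒢) (hAPQ : Distinguishes A P Q)
    (hchain : List.IsChain MAntiComm (A :: (l ++ [M]))) :
    ∃ S ∈ 𝒢, MAntiComm S M ∧ Distinguishes S P Q := by
  induction l generalizing A with
  | nil => exact ⟨A, hA, by simpa using hchain, hAPQ⟩
  | cons B l ih =>
    have hB : B ∈ 𝒢 := hl B (by simp)
    have hl' : ∀ R ∈ l, R ∈ 𝒢 := fun R hR => hl R (by simp [hR])
    rw [List.cons_append, List.isChain_cons_cons] at hchain
    obtain ⟨hAB, hchain⟩ := hchain
    by_cases hBPQ : Distinguishes B P Q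
    · exact ih hl' hB hBPQ hchain
    have hB' : (MComm B P ∧ MComm B Q) ∨ (MAntiComm B P ∧ MAntiComm B Q) := by
      unfold Distinguishes at hBPQ
      have h₁ := (h𝒢pauli B hB).mComm_or_mAntiComm hP
      have h₂ := (h𝒢pauli B hB).mComm_or_mAntiComm hQ
      tauto
    obtain ⟨c, C, hc, hC, hABC⟩ := (h𝒢pauli A hA).exists_mul_eq_smul (h𝒢pauli B hB)
    have hC𝒢 : C ∈ 𝒢 := h𝒢lie A hA B hB hAB c C hc hC hABC
    have hc0 : c ≠ 0 := by
      rintro rfl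
      simp at hc
    have hCPQ := hAPQ.of_mul_eq_smul hc0 hABC hB'
    obtain ⟨N, t, ht⟩ : ∃ N t, l ++ [M] = N :: t := List.exists_cons_of_ne_nil (by simp)
    have hN : IsPauli N := by
      have : N ∈ l ++ [M] := by simp [ht]
      rcases List.mem_append.1 this with h | h
      · exact h𝒢pauli N (hl' N h)
      · rwa [List.mem_singleton.1 h]
    rw [ht, List.isChain_cons_cons] at hchain
    rcases (h𝒢pauli A hA).mComm_or_mAntiComm hN with hAN | hAN
    · refine ih hl' hC𝒢 hCPQ ?_
      rw [ht, List.isChain_cons_cons]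
      exact ⟨.of_mul_eq_smul_right hc0 hABC hAN hchain.1, hchain.2⟩
    · refine ih hl' hA hAPQ ?_
      rw [ht, List.isChain_cons_cons]
      exact ⟨hAN, hchain.2⟩

end PauliAlgebra

/-- **Lemma 10.** Let `P, Q ∈ 𝒢` commute and be `𝔤`-connected, and
let `M` be a Pauli string `𝔤`-connected to `Q`. If some `R ∈ 𝒢` anticommutes
with exactly one of `P`, `Q` (commuting with the other), then some `S ∈ 𝒢`
anticommutes with `M` and anticommutes with exactly one of `P`, `Q` (commuting
with the other). -/
theorem exists_S_distinguishing_and_anticommuting_M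
    {n : ℕ} (hn : 1 ≤ n)
    (𝒢 : Set (Matrix (Fin n → Fin 2) (Fin n → Fin 2) ℂ))
    (h𝒢pauli : ∀ A ∈ 𝒢, IsPauli A) (h𝒢lie : LieClosed 𝒢)
    (P Q M : Matrix (Fin n → Fin 2) (Fin n → Fin 2) ℂ)
    (hP : P ∈ 𝒢) (hQ : Q ∈ 𝒢) (hM : IsPauli M)
    (hPQ : MComm P Q) (hconnPQ : GConnected 𝒢 P Q)
    (hconnQM : GConnected 𝒢 Q M)
    (hR : ∃ R ∈ 𝒢, (MAntiComm R P ∧ MComm R Q) ∨ (MComm R P ∧ MAntiComm R Q)) :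
    ∃ S ∈ 𝒢, MAntiComm S M ∧
      ((MAntiComm S P ∧ MComm S Q) ∨ (MComm S P ∧ MAntiComm S Q)) := by
  obtain ⟨-, l₁, hl₁, hchain₁⟩ := hconnPQ
  obtain ⟨-, l₂, hl₂, hchain₂⟩ := hconnQM
  obtain ⟨R, hR𝒢, hRPQ⟩ := hR
  have contract := h𝒢lie.exists_distinguishes_of_isChain (A := R) h𝒢pauli
    (h𝒢pauli P hP) (h𝒢pauli Q hQ) hM
  rcases id hRPQ with ⟨hRP, -⟩ | ⟨-, hRQ⟩
  · refine contract (P :: (l₁ ++ Q :: l₂)) ?_ hR𝒢 hRPQ ?_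
    · intro A hA
      simp only [List.mem_cons, List.mem_append] at hA
      rcases hA with rfl | hA | rfl | hA
      exacts [hP, hl₁ A hA, hQ, hl₂ A hA]
    · have h : List.IsChain MAntiComm ((P :: l₁) ++ Q :: (l₂ ++ [M])) :=
        List.isChain_split.2 ⟨hchain₁, hchain₂⟩
      simpa using List.isChain_cons_cons.2 ⟨hRP, h⟩
  · refine contract (Q :: l₂) ?_ hR𝒢 hRPQ (List.isChain_cons_cons.2 ⟨hRQ, hchain₂⟩)
    intro A hA
    rcases List.mem_cons.1 hA with rfl | hA
    exacts [hQ, hl₂ A hA]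
end
end

section
/- Let α (blocks) and β (positions within a block) be index types with a distinguished element 1 ∈ β, and let G : α → β → {n-qubit Pauli strings} satisfy: (within-block commutation) for every a and all j, k ∈ β, G_{a,j} commutes with G_{a,k}; and (uniform cross-block relations) for all a ≠ b, either G_{a,j} commutes with G_{b,k} for all j, k, or G_{a,j} anticommutes with G_{b,k} for all j, k. Define the matrices S_{a,j} = G_{a,1} * G_{a,j} and L_a = G_{a,1}. Then: (i) any two of the matrices S_{a,j} commute, i.e. S_{a,j} * S_{b,k} = S_{b,k} * S_{a,j} for all a, b, j, k; (ii) each S_{a,j} commutes with each L_b; and (iii) S_{a,j} * L_a = G_{a,j} for all a, j. -/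
open Matrix

noncomputable section

theorem pauli1_mul_self (k : Fin 4) : pauli1 k * pauli1 k = 1 := by
  fin_cases k <;> ext i j <;> fin_cases i <;> fin_cases j <;>
    simp [pauli1, Matrix.mul_apply]

theorem pauliString_mul_self {n : ℕ} (f : Fin n → Fin 4) :
    PauliString n f * PauliString n f = 1 := by
  ext x y
  calc (PauliString n f * PauliString n f) x y
      = ∑ z : Fin n → Fin 2, ∏ i, pauli1 (f i) (x i) (z i) * pauli1 (f i) (z i) (y i) := by
        simp only [Matrix.mul_apply, PauliString, Finset.prod_mul_distrib]
    _ = ∏ i, (pauli1 (f i) * pauli1 (f i)) (x i) (y i) := by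
        simp only [Matrix.mul_apply, Finset.prod_univ_sum, Fintype.piFinset_univ]
    _ = (1 : Matrix (Fin n → Fin 2) (Fin n → Fin 2) ℂ) x y := by
        simp only [pauli1_mul_self, Matrix.one_apply, Finset.prod_ite_zero, Finset.prod_const_one,
          Finset.mem_univ, true_implies, funext_iff]

theorem IsPauli.mul_self {n : ℕ} {A : Matrix (Fin n → Fin 2) (Fin n → Fin 2) ℂ}
    (hA : IsPauli A) : A * A = 1 := by
  obtain ⟨f, rfl⟩ := hA
  exact pauliString_mul_self f

theorem MComm.mul_left {n : ℕ} {A B C : Matrix (Fin n → Fin 2) (Fin n → Fin 2) ℂ}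
    (hA : MComm A C) (hB : MComm B C) : MComm (A * B) C :=
  Commute.mul_left hA hB

theorem MComm.mul_right {n : ℕ} {A B C : Matrix (Fin n → Fin 2) (Fin n → Fin 2) ℂ}
    (hB : MComm A B) (hC : MComm A C) : MComm A (B * C) :=
  Commute.mul_right hB hC

theorem MAntiComm.mul_left {n : ℕ} {A B C : Matrix (Fin n → Fin 2) (Fin n → Fin 2) ℂ}
    (hA : MAntiComm A C) (hB : MAntiComm B C) : MComm (A * B) C := by
  unfold MAntiComm at hA hB
  unfold MComm
  rw [mul_assoc, hB, mul_neg, ← mul_assoc, hA, neg_mul, neg_neg, mul_assoc]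

/-- **stabilizer formalism of commuting block circuits.** Given
block generators `G a j` (Pauli strings) that commute within blocks and have
uniform cross-block (anti)commutation relations, the matrices
`S_{a,j} = G a 1 * G a j` pairwise commute, commute with every `L_b = G b 1`,
and satisfy `S_{a,j} * L_a = G a j`. -/
theorem cbc_stabilizer_formalism
    {n : ℕ} (hn : 1 ≤ n) {α β : Type*} (one : β)
    (G : α → β → Matrix (Fin n → Fin 2) (Fin n → Fin 2) ℂ)
    (hpauli : ∀ a j, IsPauli (G a j))
    (hwithin : ∀ (a : α) (j k : β), MComm (G a j) (G a k))
    (hcross : ∀ a b : α, a ≠ b →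
      (∀ j k : β, MComm (G a j) (G b k)) ∨ (∀ j k : β, MAntiComm (G a j) (G b k))) :
    (∀ (a b : α) (j k : β), MComm (G a one * G a j) (G b one * G b k)) ∧
    (∀ (a b : α) (j : β), MComm (G a one * G a j) (G b one)) ∧
    (∀ (a : α) (j : β), (G a one * G a j) * G a one = G a j) := by
  have key : ∀ (a b : α) (j k : β), MComm (G a one * G a j) (G b k) := by
    intro a b j k
    by_cases hab : a = b
    · subst hab
      exact (hwithin a one k).mul_left (hwithin a j k)
    · rcases hcross a b hab with h | h
      · exact (h one k).mul_left (h j k)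
      · exact (h one k).mul_left (h j k)
  refine ⟨fun a b j k => (key a b j one).mul_right (key a b j k),
    fun a b j => key a b j one, fun a j => ?_⟩
  rw [hwithin a one j, mul_assoc, (hpauli a one).mul_self, mul_one]
end
end
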